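/- Let h = 2n+1 be an odd integer with n ≥ 1 and let σ be an h-bar-core having at least one addable n-node. Then every partition in P_{σ,2} has no removable n-node. -/

import Mathlib

/-- A partition: a weakly decreasing sequence of non-negative integers with
finite sum (finitely many nonzero parts), indexed from 0 (so `parts 0` is λ₁). -/
structure BPartition where
  parts : ℕ →₀ ℕ
  antitone : ∀ r, parts (r + 1) ≤ parts r

namespace BPartition

/-- The multiset of positive parts of a partition. -/
def partsM (lam : BPartition) : Multiset ℕ :=
  lam.parts.support.val.map (fun r => lam.parts r)

/-- The Young diagram: nodes `(r, c)` with rows indexed from 0 and columns from 1. -/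
def diagram (lam : BPartition) : Set (ℕ × ℕ) :=
  {x | 1 ≤ x.2 ∧ x.2 ≤ lam.parts x.1}

/-- A partition is strict if λ_r > λ_{r+1} whenever λ_r > 0. -/
def IsStrict (lam : BPartition) : Prop :=
  ∀ r, 0 < lam.parts r → lam.parts (r + 1) < lam.parts r

/-- A partition is h-strict if each part is either strictly bigger than the next,
or positive and divisible by h, or zero. -/
def IsHStrict (h : ℕ) (lam : BPartition) : Prop :=
  ∀ r, lam.parts (r + 1) < lam.parts r ∨ (0 < lam.parts r ∧ h ∣ lam.parts r) ∨ lam.parts r = 0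

/-- An h-strict partition is restricted if for every r either λ_{r+1} > λ_r − h,
or λ_{r+1} = λ_r − h and h does not divide λ_r. -/
def IsRestricted (h : ℕ) (lam : BPartition) : Prop :=
  ∀ r, lam.parts r < lam.parts (r + 1) + h ∨
    (lam.parts (r + 1) + h = lam.parts r ∧ ¬ h ∣ lam.parts r)

/-- The residue of a node in column c (1-indexed): the smaller of the residues of
c − 1 and of −c modulo h. -/
def colRes (h c : ℕ) : ℕ := min ((c - 1) % h) ((h - c % h) % h)

/-- `x` is an addable i-node of `lam`. -/
def Addable (h i : ℕ) (lam : BPartition) (x : ℕ × ℕ) : Prop :=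
  colRes h x.2 = i ∧ x ∉ diagram lam ∧
  ∃ nu : BPartition, IsHStrict h nu ∧ diagram lam ⊆ diagram nu ∧ x ∈ diagram nu ∧
    ∀ y ∈ diagram nu, y ∉ diagram lam → colRes h y.2 = i

/-- `x` is a removable i-node of `lam`. -/
def Removable (h i : ℕ) (lam : BPartition) (x : ℕ × ℕ) : Prop :=
  x ∈ diagram lam ∧
  ∃ mu : BPartition, IsHStrict h mu ∧ diagram mu ⊆ diagram lam ∧ x ∉ diagram mu ∧
    ∀ y ∈ diagram lam, y ∉ diagram mu → colRes h y.2 = i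

/-- Removal of a single h-bar from `lam` giving `mu`, recording the value `v`:
either a part `v ≥ h` is replaced by `v − h` (deleted if `v = h`), or two parts
summing to `h` are deleted, in which case `v` is the larger of the two. -/
def barStepRec (h : ℕ) (lam mu : BPartition) (v : ℕ) : Prop :=
  IsHStrict h mu ∧
  ((v = h ∧ v ∈ partsM lam ∧ partsM mu = (partsM lam).erase v) ∨
   (h < v ∧ v ∈ partsM lam ∧ partsM mu = (v - h) ::ₘ (partsM lam).erase v) ∨
   (∃ a b : ℕ, a + b = h ∧ a ∈ partsM lam ∧ b ∈ (partsM lam).erase a ∧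
      v = max a b ∧ partsM mu = ((partsM lam).erase a).erase b))

/-- Removal of a single h-bar. -/
def barStep (h : ℕ) (lam mu : BPartition) : Prop :=
  ∃ v, barStepRec h lam mu v

/-- An h-bar-core: an h-strict partition from which no h-bar can be removed. -/
def IsBarCore (h : ℕ) (lam : BPartition) : Prop :=
  IsHStrict h lam ∧ ∀ mu, ¬ barStep h lam mu

/-- A chain of `w` h-bar removals from `lam` down to `mu`. -/
def barChain (h : ℕ) : ℕ → BPartition → BPartition → Prop
  | 0, lam, mu => lam = mu
  | w + 1, lam, mu => ∃ nu, barStep h lam nu ∧ barChain h w nu mu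

/-- `lam ∈ P_{τ,w}`: `lam` is h-strict with h-bar-core `tau` and h-bar-weight `w`. -/
def InBlock (h : ℕ) (tau : BPartition) (w : ℕ) (lam : BPartition) : Prop :=
  IsHStrict h lam ∧ IsBarCore h tau ∧ barChain h w lam tau

/-- The left-to-right order on node positions along the edge of a Young diagram:
smaller column first; within a column, larger row first. -/
def posLE (x y : ℕ × ℕ) : Prop := x.2 < y.2 ∨ (x.2 = y.2 ∧ y.1 ≤ x.1)

/-- `x` is a normal i-node: a removable i-node surviving (as a − sign) in the
reduced i-signature; equivalently, every window of the i-signature ending at `x`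
contains strictly more removable than addable i-nodes. -/
def Normal (h i : ℕ) (lam : BPartition) (x : ℕ × ℕ) : Prop :=
  Removable h i lam x ∧ ∀ z : ℕ × ℕ, posLE z x →
    Set.ncard {y | Addable h i lam y ∧ posLE z y ∧ posLE y x} <
      Set.ncard {y | Removable h i lam y ∧ posLE z y ∧ posLE y x}

/-- `x` is a conormal i-node: an addable i-node surviving (as a + sign) in the
reduced i-signature. -/
def Conormal (h i : ℕ) (lam : BPartition) (x : ℕ × ℕ) : Prop :=
  Addable h i lam x ∧ ∀ z : ℕ × ℕ, posLE x z →
    Set.ncard {y | Removable h i lam y ∧ posLE x y ∧ posLE y z} <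
      Set.ncard {y | Addable h i lam y ∧ posLE x y ∧ posLE y z}

/-- The node set of ψ_i(λ): add the leftmost s − r conormal i-nodes if s ≥ r,
remove the rightmost r − s normal i-nodes if r > s, where r = #normal and
s = #conormal i-nodes. -/
noncomputable def psiSet (h i : ℕ) (lam : BPartition) : Set (ℕ × ℕ) :=
  if Set.ncard {x | Normal h i lam x} ≤ Set.ncard {x | Conormal h i lam x} then
    diagram lam ∪ {x | Conormal h i lam x ∧
      Set.ncard {y | Conormal h i lam y ∧ posLE y x} ≤
        Set.ncard {x | Conormal h i lam x} - Set.ncard {x | Normal h i lam x}}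
  else
    diagram lam \ {x | Normal h i lam x ∧
      Set.ncard {y | Normal h i lam y ∧ posLE x y} ≤
        Set.ncard {x | Normal h i lam x} - Set.ncard {x | Conormal h i lam x}}

open Classical in
/-- The involution ψ_i. -/
noncomputable def psi (h i : ℕ) (lam : BPartition) : BPartition :=
  if hex : ∃ mu : BPartition, diagram mu = psiSet h i lam then hex.choose else lam

/-- The set of occupied positions of the abacus display of a strict partition. -/
def abacus (lam : BPartition) : Set ℤ :=
  {a | a = 0 ∨ (0 < a ∧ a.toNat ∈ partsM lam) ∨ (a < 0 ∧ (-a).toNat ∉ partsM lam)}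

/-- The dominance order: λ ⊴ μ. -/
def domLE (lam mu : BPartition) : Prop :=
  ∀ r, ∑ s ∈ Finset.range r, lam.parts s ≤ ∑ s ∈ Finset.range r, mu.parts s

/-- Strict dominance: λ ◁ μ. -/
def domLT (lam mu : BPartition) : Prop := domLE lam mu ∧ lam ≠ mu

/-- Lexicographic order: λ <lex μ. -/
def lexLT (lam mu : BPartition) : Prop :=
  ∃ r, lam.parts r < mu.parts r ∧ ∀ s < r, lam.parts s = mu.parts s

/-- Colexicographic order: λ <colex μ. -/
def colexLT (lam mu : BPartition) : Prop :=
  ∃ r, mu.parts r < lam.parts r ∧ ∀ s, r < s → lam.parts s = mu.parts s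

/-- λ ↔ᵢ μ: every node of the symmetric difference of the diagrams has residue i. -/
def Link (h i : ℕ) (lam mu : BPartition) : Prop :=
  ∀ x : ℕ × ℕ, x ∈ (diagram lam \ diagram mu) ∪ (diagram mu \ diagram lam) →
    colRes h x.2 = i

/-- `a ≤ b` are the bar positions of `lam ∈ P_{τ,2}`: the values recorded by
some two-step removal of h-bars from `lam` down to `tau`. -/
def BarPositions (h : ℕ) (tau lam : BPartition) (a b : ℕ) : Prop :=
  a ≤ b ∧ ∃ (nu : BPartition) (v₁ v₂ : ℕ), barStepRec h lam nu v₁ ∧ barStepRec h nu tau v₂ ∧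
    ({a, b} : Multiset ℕ) = {v₁, v₂}

/-- The leg length of the bar of `lam ∈ P_{τ,2}` at bar position `c`. -/
noncomputable def legLen (h : ℕ) (tau lam : BPartition) (c : ℕ) : ℕ :=
  if h ≤ c then Set.ncard {x : ℕ | c - h < x ∧ x < c ∧ x ∈ partsM lam ∧ x ∈ partsM tau}
  else (h - c) + Set.ncard {x : ℕ | h - c < x ∧ x < c ∧ x ∈ partsM lam ∧ x ∈ partsM tau}

/-- ∂λ: the absolute difference of the two leg lengths of `lam`, whose bar
positions are `a ≤ b`. -/
noncomputable def ddd (h : ℕ) (tau lam : BPartition) (a b : ℕ) : ℕ :=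
  max (legLen h tau lam a) (legLen h tau lam b) - min (legLen h tau lam a) (legLen h tau lam b)

inductive Colour | black | white | grey
deriving DecidableEq

/-- β(τ): the number of parts of τ less than h. -/
def betaCount (h : ℕ) (tau : BPartition) : ℕ :=
  Multiset.card ((partsM tau).filter (fun x => x < h))

/-- The leg length of a 2h-bar of `lam` with larger bar position `b`. -/
noncomputable def legLen2 (h : ℕ) (tau lam : BPartition) (b : ℕ) : ℕ :=
  if 2 * h ≤ b then Set.ncard {x : ℕ | b - 2 * h < x ∧ x < b ∧ x ∈ partsM lam ∧ x ∈ partsM tau}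
  else (2 * h - b) + Set.ncard {x : ℕ | 2 * h - b < x ∧ x < b ∧ x ∈ partsM lam ∧ x ∈ partsM tau}

/-- The colour of `lam ∈ P_{τ,2}` with bar positions `a ≤ b`. -/
noncomputable def colour (h : ℕ) (tau lam : BPartition) (a b : ℕ) : Colour :=
  if 2 ≤ ddd h tau lam a b then Colour.grey
  else if ddd h tau lam a b = 1 then
    if h < b then Colour.grey
    else if (min (legLen h tau lam a) (legLen h tau lam b) + betaCount h tau) % 2 = 1 then
      Colour.black else Colour.white
  else
    if b = a + h ∨ a + b = 2 * h then
      if (legLen2 h tau lam b + 2 * betaCount h tau) % 4 = 0 ∨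
         (legLen2 h tau lam b + 2 * betaCount h tau) % 4 = 3 then Colour.black
      else Colour.white
    else
      if (legLen h tau lam a + betaCount h tau) % 2 = 1 then Colour.black else Colour.white

end BPartition

namespace BPartition

theorem s7_anti (lam : BPartition) : Antitone lam.parts := antitone_nat_of_succ_le lam.antitone

theorem s7_mem (lam : BPartition) (v : ℕ) :
    v ∈ partsM lam ↔ 0 < v ∧ ∃ r, lam.parts r = v := by
  unfold partsM
  simp only [Multiset.mem_map, Finset.mem_val, Finsupp.mem_support_iff]
  constructor
  · rintro ⟨r, h1, rfl⟩; exact ⟨by omega, r, rfl⟩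
  · rintro ⟨h1, r, rfl⟩; exact ⟨r, by omega, rfl⟩

theorem s7_count (lam : BPartition) (v : ℕ) :
    Multiset.count v (partsM lam) = (lam.parts.support.filter (fun r => v = lam.parts r)).card := by
  unfold partsM
  rw [Multiset.count_map]; rfl

theorem s7_count_le {h : ℕ} {lam : BPartition} (hs : IsHStrict h lam) {v : ℕ} (hv : ¬ h ∣ v) :
    Multiset.count v (partsM lam) ≤ 1 := by
  have key : ∀ a b, lam.parts a = v → lam.parts b = v → v ≠ 0 → ¬ a < b := by
    intro a b ha hb h0 hab
    have h1 := s7_anti lam (show a + 1 ≤ b from hab)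
    rcases hs a with h2 | h2 | h2
    · omega
    · rw [ha] at h2; exact hv h2.2
    · omega
  rw [s7_count, Finset.card_le_one]
  intro a ha b hb
  simp only [Finset.mem_filter, Finsupp.mem_support_iff] at ha hb
  have h1 := key a b ha.2.symm hb.2.symm (by rw [ha.2]; exact ha.1)
  have h2 := key b a hb.2.symm ha.2.symm (by rw [ha.2]; exact ha.1)
  omega

theorem s7_strict {h : ℕ} {lam : BPartition}
    (hc : ∀ v, ¬ h ∣ v → Multiset.count v (partsM lam) ≤ 1) : IsHStrict h lam := by
  intro r
  by_contra hcon
  push Not at hcon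
  obtain ⟨h1, h2, h3⟩ := hcon
  have h4 := lam.antitone r
  have h5 := hc _ (h2 (by omega))
  rw [s7_count, Finset.card_le_one] at h5
  have := h5 r (by simp [h3]) (r+1) (by simp; omega)
  omega

theorem s7_exists (M : Multiset ℕ) (h0 : ∀ v ∈ M, 0 < v) : ∃ mu : BPartition, partsM mu = M := by
  classical
  set L := M.sort (· ≥ ·) with hL
  have hp : L.Pairwise (· ≥ ·) := Multiset.pairwise_sort M (· ≥ ·)
  have hLM : (L : Multiset ℕ) = M := Multiset.sort_eq M (· ≥ ·)
  have hpos : ∀ r (hr : r < L.length), 0 < L[r] := by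
    intro r hr
    apply h0
    rw [← hLM]
    exact List.getElem_mem hr
  have hmem : ∀ r, r ∈ Finset.range L.length ↔ L.getD r 0 ≠ 0 := by
    intro r
    rw [Finset.mem_range]
    constructor
    · intro hr
      have := hpos r hr
      rw [List.getD_eq_getElem _ _ hr]; omega
    · intro hr
      by_contra hlt
      exact hr (List.getD_eq_default _ _ (by omega))
  refine ⟨⟨⟨Finset.range L.length, fun r => L.getD r 0, hmem⟩, ?_⟩, ?_⟩
  · intro r
    change L.getD (r+1) 0 ≤ L.getD r 0
    by_cases hr : r + 1 < L.length
    · rw [List.getD_eq_getElem _ _ hr, List.getD_eq_getElem _ _ (by omega : r < L.length)]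
      exact List.pairwise_iff_getElem.1 hp r (r+1) (by omega) hr (by omega)
    · rw [List.getD_eq_default _ _ (by omega)]; omega
  · change (Finset.range L.length).val.map (fun r => L.getD r 0) = M
    rw [← hLM]
    change (((List.range L.length).map (fun r => L.getD r 0) : List ℕ) : Multiset ℕ) = L
    congr 1
    apply List.ext_getElem
    · simp
    · intro i h1 h2
      simp [h2]

theorem s7_colRes {n h c : ℕ} (hn : 1 ≤ n) (hh : h = 2 * n + 1) (hc : 1 ≤ c)
    (hr : colRes h c = n) : c % h = n + 1 := by
  unfold colRes at hr
  have hlt : c % h < h := Nat.mod_lt _ (by omega)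
  by_cases h0 : c % h = 0
  · rw [h0] at hr; simp at hr; omega
  · have e : (c - 1) % h = c % h - 1 := by
      have hd := Nat.div_add_mod c h
      have : c - 1 = (c % h - 1) + h * (c / h) := by omega
      rw [this, Nat.add_mul_mod_self_left, Nat.mod_eq_of_lt (by omega)]
    rw [e, Nat.mod_eq_of_lt (by omega : h - c % h < h)] at hr
    omega

theorem s7_succ {n h c : ℕ} (hn : 1 ≤ n) (hh : h = 2 * n + 1) (hc : (c+1) % h = n + 1) :
    c % h = n := by
  have hd := Nat.div_add_mod (c+1) h
  have : c = n + h * ((c+1) / h) := by omega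
  rw [this, Nat.add_mul_mod_self_left, Nat.mod_eq_of_lt (by omega)]

theorem s7_sub {h v : ℕ} (hv : h ≤ v) : (v - h) % h = v % h := by
  rw [Nat.mod_eq_sub_mod hv]

theorem s7_ndvd {h v m : ℕ} (hm : 0 < m) (hv : v % h = m) : ¬ h ∣ v := by
  intro hd
  have := Nat.mod_eq_zero_of_dvd hd
  omega

/-- descent in cores -/
theorem s7_core_desc {h : ℕ} {σ : BPartition} (hσ : IsBarCore h σ) {m : ℕ} (hm : 0 < m)
    (p : ℕ) : p ∈ partsM σ → p % h = m → m ∈ partsM σ := by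
  induction p using Nat.strong_induction_on with
  | _ p ih =>
    intro hp hpm
    by_cases hlt : p < h
    · rw [Nat.mod_eq_of_lt hlt] at hpm; rwa [← hpm]
    · have hne : p ≠ h := by rintro rfl; simp at hpm; omega
      have hp0 := ((s7_mem _ _).1 hp).1
      have hh0 : 0 < h := by
        rcases Nat.eq_zero_or_pos h with rfl | h0
        · have hnd := s7_ndvd hm hpm
          exfalso
          -- h = 0: replacing p by p - 0 gives a bar removal
          refine hσ.2 σ ⟨p, hσ.1, Or.inr (Or.inl ⟨hp0, hp, ?_⟩)⟩
          rw [Nat.sub_zero, Multiset.cons_erase hp]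
        · exact h0
      by_cases hin : p - h ∈ partsM σ
      · exact ih (p - h) (by omega) hin (by rw [s7_sub (by omega), hpm])
      · exfalso
        obtain ⟨mu, hmu⟩ := s7_exists ((p - h) ::ₘ (partsM σ).erase p) (by
          intro v hv
          rw [Multiset.mem_cons] at hv
          rcases hv with rfl | hv
          · omega
          · exact ((s7_mem _ _).1 (Multiset.mem_of_mem_erase hv)).1)
        refine hσ.2 mu ⟨p, ?_, Or.inr (Or.inl ⟨by omega, hp, hmu⟩)⟩
        apply s7_strict
        intro v hv
        rw [hmu, Multiset.count_cons]
        have hle := s7_count_le hσ.1 hv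
        have hle2 := Multiset.count_le_of_le v (Multiset.erase_le p (partsM σ))
        split_ifs with hvp
        · subst hvp
          rw [Multiset.count_eq_zero_of_notMem hin] at hle2
          omega
        · omega

theorem s7_core_pair {h : ℕ} {σ : BPartition} (hσ : IsBarCore h σ) {a b : ℕ} (hab : a + b = h)
    (hne : a ≠ b) (ha : a ∈ partsM σ) (hb : b ∈ partsM σ) : False := by
  obtain ⟨mu, hmu⟩ := s7_exists (((partsM σ).erase a).erase b) (by
    intro v hv
    exact ((s7_mem _ _).1 (Multiset.mem_of_mem_erase (Multiset.mem_of_mem_erase hv))).1)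
  refine hσ.2 mu ⟨max a b, ?_, Or.inr (Or.inr ⟨a, b, hab, ha,
    (Multiset.mem_erase_of_ne hne.symm).2 hb, rfl, hmu⟩)⟩
  apply s7_strict
  intro v hv
  rw [hmu]
  have hle := s7_count_le hσ.1 hv
  have h2 := Multiset.count_le_of_le v (Multiset.erase_le a (partsM σ))
  have h3 := Multiset.count_le_of_le v (Multiset.erase_le b ((partsM σ).erase a))
  omega

theorem s7_step {n h : ℕ} (hn : 1 ≤ n) (hh : h = 2 * n + 1) {nu mu : BPartition}
    (hs : IsHStrict h nu) (hstep : barStep h nu mu)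
    (hB : ∀ q ∈ partsM mu, q % h ≠ n + 1) {q : ℕ} (hq : q ∈ partsM nu) (hqm : q % h = n + 1) :
    q = n + 1 ∧ n ∈ partsM nu ∧ n ∉ partsM mu := by
  obtain ⟨v, _, ⟨rfl, _, he⟩ | ⟨hlt, _, he⟩ | ⟨a, b, hab, ha, hb, _, he⟩⟩ := hstep
  · exfalso
    refine hB q ?_ hqm
    rw [he]
    refine (Multiset.mem_erase_of_ne ?_).2 hq
    rintro rfl; simp at hqm
  · exfalso
    by_cases hqv : q = v
    · subst hqv
      refine hB (q - h) ?_ (by rw [s7_sub hlt.le, hqm])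
      rw [he]; exact Multiset.mem_cons_self _ _
    · refine hB q ?_ hqm
      rw [he, Multiset.mem_cons]
      exact Or.inr ((Multiset.mem_erase_of_ne hqv).2 hq)
  · have hb' := Multiset.mem_of_mem_erase hb
    have hnd : ¬ h ∣ n := s7_ndvd (m := n) hn (Nat.mod_eq_of_lt (by omega))
    have hc := s7_count_le hs hnd
    have ha0 := ((s7_mem _ _).1 ha).1
    have hb0 := ((s7_mem _ _).1 hb').1
    by_cases h1 : q = a
    · rw [Nat.mod_eq_of_lt (by omega)] at hqm
      have hbn : b = n := by omega
      refine ⟨hqm, hbn ▸ hb', ?_⟩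
      rw [he, hbn, ← Multiset.count_eq_zero, Multiset.count_erase_self,
        Multiset.count_erase_of_ne (by omega)]
      omega
    · by_cases h2 : q = b
      · rw [Nat.mod_eq_of_lt (by omega)] at hqm
        have han : a = n := by omega
        refine ⟨hqm, han ▸ ha, ?_⟩
        rw [he, han, ← Multiset.count_eq_zero, Multiset.count_erase_of_ne (by omega),
          Multiset.count_erase_self]
        omega
      · exfalso
        refine hB q ?_ hqm
        rw [he]
        exact (Multiset.mem_erase_of_ne h2).2 ((Multiset.mem_erase_of_ne h1).2 hq)

/-- two consecutive columns cannot both have residue n -/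
theorem s7_consec {n h c : ℕ} (hn : 1 ≤ n) (hh : h = 2 * n + 1) (hc : 1 ≤ c)
    (h1 : colRes h c = n) (h2 : colRes h (c+1) = n) : False := by
  have e1 := s7_colRes hn hh hc h1
  have e2 := s7_succ hn hh (s7_colRes hn hh (by omega) h2)
  omega

theorem s7_addable {n h : ℕ} (hn : 1 ≤ n) (hh : h = 2 * n + 1) {σ : BPartition} {x : ℕ × ℕ}
    (hx : Addable h n σ x) : ∃ p ∈ partsM σ, p % h = n := by
  obtain ⟨r, c⟩ := x
  obtain ⟨hr, hnot, nu, _, _, hmem, hall⟩ := hx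
  simp only [diagram, Set.mem_setOf_eq] at hr hnot hmem hall
  have e1 := s7_colRes hn hh hmem.1 hr
  have hc1 : c ≠ 1 := by
    rintro rfl
    rw [Nat.mod_eq_of_lt (by omega)] at e1; omega
  obtain ⟨d, rfl⟩ : ∃ d, c = d + 1 := ⟨c - 1, by omega⟩
  have hd : σ.parts r = d := by
    by_contra hne
    have := hall (r, d) ⟨by dsimp only; omega, by dsimp only; omega⟩ (by dsimp only; omega)
    exact s7_consec hn hh (by omega) this hr
  exact ⟨d, (s7_mem _ _).2 ⟨by omega, r, hd⟩, s7_succ hn hh e1⟩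

theorem s7_removable {n h : ℕ} (hn : 1 ≤ n) (hh : h = 2 * n + 1) {lam : BPartition}
    (hs : IsHStrict h lam) {x : ℕ × ℕ}
    (hx : Removable h n lam x) : ∃ q, q + 1 ∈ partsM lam ∧ (q + 1) % h = n + 1 ∧ q ∉ partsM lam := by
  obtain ⟨r, c⟩ := x
  obtain ⟨hmem, mu, hmu, hsub, hnot, hall⟩ := hx
  have hr := hall _ hmem hnot
  simp only [diagram, Set.mem_setOf_eq] at hr hnot hmem hall
  have e1 := s7_colRes hn hh hmem.1 hr
  obtain ⟨d, rfl⟩ : ∃ d, c = d + 1 := ⟨c - 1, by omega⟩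
  have e2 := s7_succ hn hh e1
  have hl : lam.parts r = d + 1 := by
    by_contra hne
    have := hall (r, d + 2) ⟨by dsimp only; omega, by dsimp only; omega⟩ (by dsimp only; omega)
    exact s7_consec hn hh (by omega) hr this
  refine ⟨d, (s7_mem _ _).2 ⟨by omega, r, hl⟩, e1, ?_⟩
  intro hd
  obtain ⟨hd0, s, hsd⟩ := (s7_mem _ _).1 hd
  have hrs : r < s := by
    by_contra hcon
    have := s7_anti lam (show s ≤ r by omega)
    omega
  have h1 := s7_anti lam (show r + 1 ≤ s from hrs)
  have hmr := hmu r
  have hma := mu.antitone r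
  have hdn : ¬ h ∣ d := s7_ndvd (m := n) hn e2
  have hlt : mu.parts (r+1) < d := by
    rcases Nat.lt_or_ge (mu.parts r) d with h3 | h3
    · omega
    · have h4 : mu.parts r = d := by omega
      rw [h4] at hmr
      rcases hmr with h5 | h5 | h5
      · exact h5
      · exact absurd h5.2 hdn
      · omega
  have := hall (r+1, d) ⟨hd0, by dsimp only; omega⟩ (by dsimp only; omega)
  have := s7_colRes hn hh hd0 this
  omega

end BPartition

open BPartition in
/-- If σ is an h-bar-core with at least one addable n-node, then no partition in
P_{σ,2} has a removable n-node. -/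
theorem stmt7 (n h : ℕ) (hn : 1 ≤ n) (hh : h = 2 * n + 1)
    (σ : BPartition) (hσ : IsBarCore h σ) (hadd : ∃ x, Addable h n σ x) :
    ∀ lam, InBlock h σ 2 lam → ∀ x, ¬ Removable h n lam x := by
  intro lam hlam x hx
  obtain ⟨y, hy⟩ := hadd
  obtain ⟨p, hp, hpm⟩ := s7_addable hn hh hy
  have hnσ := s7_core_desc hσ hn p hp hpm
  have hBσ : ∀ q ∈ partsM σ, q % h ≠ n + 1 := by
    intro q hq hqm
    exact s7_core_pair hσ (by omega : n + (n + 1) = h) (by omega) hnσ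
      (s7_core_desc hσ (by omega) q hq hqm)
  obtain ⟨hs, _, nu, hst1, nu', hst2, hEq⟩ := hlam
  have hEq' : nu' = σ := hEq
  subst hEq'
  have hnu : IsHStrict h nu := hst1.choose_spec.1
  have hBν : ∀ q ∈ partsM nu, q % h ≠ n + 1 := by
    intro q hq hqm
    exact (s7_step hn hh hnu hst2 hBσ hq hqm).2.2 hnσ
  obtain ⟨q, hq, hqm, hqn⟩ := s7_removable hn hh hs hx
  obtain ⟨e, hnl, _⟩ := s7_step hn hh hs hst1 hBν hq hqm
  have : q = n := by omega
  exact hqn (this ▸ hnl)
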